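/- arXiv:1907.01310 — 2 statements merged into one kernel-verified Lean document; each statement's English description precedes it below -/
import Mathlib

section
/- Let E be a TOM on a finite vertex set V with internal space ℂ^d, let V = V₋ ∪ V₀ ∪ V₊ be a partition, and suppose E admits an overlapping decomposition with overlap V₀ given by TOMs E_L on V_L = V₋ ∪ V₀, E_R on V_R = V₀ ∪ V₊ and E₀ on V₀. Then for every density ρ supported on the sum of sites S₀ indexed by V₀, the return probabilities satisfy π(ρ→S₀) = π_L(ρ→S₀) + π_R(ρ→S₀) − 1, where π_L and π_R are the return probabilities of S₀ with respect to E_L and E_R. Consequently S₀ is recurrent for E if and only if S₀ is recurrent for both E_L and E_R. -/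
open Matrix Filter
open scoped ComplexOrder ENNReal

namespace QMCTOM

variable {d : ℕ} {V : Type} [Fintype V] [DecidableEq V]

/-- A completely positive map on `M_d(ℂ)`: one admitting a finite Kraus
representation. -/
def IsCPMap (Φ : Matrix (Fin d) (Fin d) ℂ →ₗ[ℂ] Matrix (Fin d) (Fin d) ℂ) : Prop :=
  ∃ (m : ℕ) (B : Fin m → Matrix (Fin d) (Fin d) ℂ),
    ∀ ρ, Φ ρ = ∑ i, B i * ρ * (B i)ᴴ

/-- A transition operator matrix (TOM) supported on a subset `S` of the vertex
set `V`: a family of CP maps `E i j`, vanishing unless `i, j ∈ S`, whose column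
sums over `S` are trace preserving. A TOM on `V` itself corresponds to
`S = Finset.univ`. -/
def IsTOMOn (S : Finset V)
    (E : V → V → (Matrix (Fin d) (Fin d) ℂ →ₗ[ℂ] Matrix (Fin d) (Fin d) ℂ)) : Prop :=
  (∀ i j, IsCPMap (E i j)) ∧
  (∀ i j, (i ∉ S ∨ j ∉ S) → E i j = 0) ∧
  (∀ j ∈ S, ∀ ρ : Matrix (Fin d) (Fin d) ℂ, (∑ i, (E i j) ρ).trace = ρ.trace)

/-- The action of a TOM on block-diagonal operators `(ρ_j)_{j∈V}`:
`(Eρ)_i = Σ_j E_i^j(ρ_j)`. -/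
noncomputable def tomAct
    (E : V → V → (Matrix (Fin d) (Fin d) ℂ →ₗ[ℂ] Matrix (Fin d) (Fin d) ℂ)) :
    (V → Matrix (Fin d) (Fin d) ℂ) →ₗ[ℂ] (V → Matrix (Fin d) (Fin d) ℂ) where
  toFun ρ i := ∑ j, E i j (ρ j)
  map_add' x y := by
    funext i
    simp [map_add, Finset.sum_add_distrib]
  map_smul' c x := by
    funext i
    simp [_root_.map_smul, Finset.smul_sum]

/-- The projection `ℙ₀` of block-diagonal operators zeroing all components
outside `S`. -/
noncomputable def siteProj (S : Finset V) :
    (V → Matrix (Fin d) (Fin d) ℂ) →ₗ[ℂ] (V → Matrix (Fin d) (Fin d) ℂ) where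
  toFun ρ i := if i ∈ S then ρ i else 0
  map_add' x y := by
    funext i
    by_cases h : i ∈ S <;> simp [h]
  map_smul' c x := by
    funext i
    by_cases h : i ∈ S <;> simp [h]

/-- Total trace of a block-diagonal operator. -/
noncomputable def blockTrace (ρ : V → Matrix (Fin d) (Fin d) ℂ) : ℂ :=
  ∑ i, (ρ i).trace

/-- `retA E S n` is `𝔸_{n+1} = ℙ₀ ∘ E ∘ (ℚ₀∘E)^n ∘ ℙ₀`, where `ℙ₀ = siteProj S`
and `ℚ₀ = id − ℙ₀`. -/
noncomputable def retA
    (E : V → V → (Matrix (Fin d) (Fin d) ℂ →ₗ[ℂ] Matrix (Fin d) (Fin d) ℂ))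
    (S : Finset V) (n : ℕ) :
    (V → Matrix (Fin d) (Fin d) ℂ) →ₗ[ℂ] (V → Matrix (Fin d) (Fin d) ℂ) :=
  (siteProj S) ∘ₗ (tomAct E) ∘ₗ
    (((LinearMap.id - siteProj S) ∘ₗ tomAct E) ^ n) ∘ₗ (siteProj S)

/-- A density supported on the sum of sites indexed by `S`. -/
def DensityOn (S : Finset V) (ρ : V → Matrix (Fin d) (Fin d) ℂ) : Prop :=
  (∀ j, (ρ j).PosSemidef) ∧ (∀ j ∉ S, ρ j = 0) ∧ blockTrace ρ = 1

/-- Return probability `π(ρ→S₀) = Σ_{n≥1} Tr(𝔸_n(ρ))`. -/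
noncomputable def returnProb
    (E : V → V → (Matrix (Fin d) (Fin d) ℂ →ₗ[ℂ] Matrix (Fin d) (Fin d) ℂ))
    (S : Finset V) (ρ : V → Matrix (Fin d) (Fin d) ℂ) : ℝ :=
  ∑' n : ℕ, (blockTrace ((retA E S n) ρ)).re

/-- Expected return time `τ(ρ→S₀) = Σ_{n≥1} n·Tr(𝔸_n(ρ))` if `π(ρ→S₀) = 1`,
and `∞` otherwise. -/
noncomputable def expReturnTime
    (E : V → V → (Matrix (Fin d) (Fin d) ℂ →ₗ[ℂ] Matrix (Fin d) (Fin d) ℂ))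
    (S : Finset V) (ρ : V → Matrix (Fin d) (Fin d) ℂ) : ℝ≥0∞ :=
  if returnProb E S ρ = 1 then
    ∑' n : ℕ, ENNReal.ofReal ((n + 1) * (blockTrace ((retA E S n) ρ)).re)
  else ⊤

/-- The sum of sites `S` is recurrent for `E`. -/
def RecurrentOn
    (E : V → V → (Matrix (Fin d) (Fin d) ℂ →ₗ[ℂ] Matrix (Fin d) (Fin d) ℂ))
    (S : Finset V) : Prop :=
  ∀ ρ, DensityOn S ρ → returnProb E S ρ = 1

/-- The sum of sites `S` is positive recurrent for `E`. -/
def PosRecurrentOn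
    (E : V → V → (Matrix (Fin d) (Fin d) ℂ →ₗ[ℂ] Matrix (Fin d) (Fin d) ℂ))
    (S : Finset V) : Prop :=
  ∀ ρ, DensityOn S ρ → expReturnTime E S ρ < ⊤

set_option linter.unusedSectionVars false

theorem IsCPMap.posSemidef {Φ : Matrix (Fin d) (Fin d) ℂ →ₗ[ℂ] Matrix (Fin d) (Fin d) ℂ}
    (hΦ : IsCPMap Φ) {x : Matrix (Fin d) (Fin d) ℂ} (hx : x.PosSemidef) :
    (Φ x).PosSemidef := by
  obtain ⟨m, B, hB⟩ := hΦ
  rw [hB]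
  exact Matrix.posSemidef_sum _ fun i _ => hx.mul_mul_conjTranspose_same (B i)

theorem blockTrace_add (x y : V → Matrix (Fin d) (Fin d) ℂ) :
    blockTrace (x + y) = blockTrace x + blockTrace y := by
  simp [blockTrace, Finset.sum_add_distrib]

theorem blockTrace_sub (x y : V → Matrix (Fin d) (Fin d) ℂ) :
    blockTrace (x - y) = blockTrace x - blockTrace y := by
  simp [blockTrace, Finset.sum_sub_distrib]

theorem blockTrace_re_nonneg {x : V → Matrix (Fin d) (Fin d) ℂ}
    (hx : ∀ j, (x j).PosSemidef) : 0 ≤ (blockTrace x).re := by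
  rw [blockTrace, Complex.re_sum]
  exact Finset.sum_nonneg fun i _ => (Complex.le_def.1 (hx i).trace_nonneg).1

theorem siteProj_apply (S : Finset V) (x : V → Matrix (Fin d) (Fin d) ℂ) (i : V) :
    siteProj S x i = if i ∈ S then x i else 0 := rfl

theorem siteProj_of_support {S : Finset V} {x : V → Matrix (Fin d) (Fin d) ℂ}
    (hx : ∀ j ∉ S, x j = 0) : siteProj S x = x := by
  funext i
  by_cases h : i ∈ S <;> simp [siteProj_apply, h, hx]

theorem siteProj_posSemidef (S : Finset V) {x : V → Matrix (Fin d) (Fin d) ℂ}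
    (hx : ∀ j, (x j).PosSemidef) (j : V) : (siteProj S x j).PosSemidef := by
  rw [siteProj_apply]
  split_ifs
  exacts [hx j, Matrix.PosSemidef.zero]

theorem tomAct_apply
    (E : V → V → (Matrix (Fin d) (Fin d) ℂ →ₗ[ℂ] Matrix (Fin d) (Fin d) ℂ))
    (x : V → Matrix (Fin d) (Fin d) ℂ) (i : V) : tomAct E x i = ∑ j, E i j (x j) := rfl

/-- The part of `Ex` that lies outside the sites in `S`. -/
noncomputable def exitStep
    (E : V → V → (Matrix (Fin d) (Fin d) ℂ →ₗ[ℂ] Matrix (Fin d) (Fin d) ℂ))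
    (S : Finset V) :
    (V → Matrix (Fin d) (Fin d) ℂ) →ₗ[ℂ] (V → Matrix (Fin d) (Fin d) ℂ) :=
  (LinearMap.id - siteProj S) ∘ₗ tomAct E

theorem exitStep_apply
    (E : V → V → (Matrix (Fin d) (Fin d) ℂ →ₗ[ℂ] Matrix (Fin d) (Fin d) ℂ))
    (S : Finset V) (x : V → Matrix (Fin d) (Fin d) ℂ) (i : V) :
    exitStep E S x i = if i ∈ S then 0 else tomAct E x i := by
  by_cases h : i ∈ S <;> simp [exitStep, siteProj_apply, h]

theorem retA_apply_of_support
    (E : V → V → (Matrix (Fin d) (Fin d) ℂ →ₗ[ℂ] Matrix (Fin d) (Fin d) ℂ))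
    {S : Finset V} {x : V → Matrix (Fin d) (Fin d) ℂ} (hx : ∀ j ∉ S, x j = 0) (n : ℕ) :
    retA E S n x = siteProj S (tomAct E ((exitStep E S ^ n) x)) := by
  simp [retA, exitStep, siteProj_of_support hx]

section TOM

variable {S T : Finset V}
  {E : V → V → (Matrix (Fin d) (Fin d) ℂ →ₗ[ℂ] Matrix (Fin d) (Fin d) ℂ)}

theorem IsTOMOn.tomAct_eq_zero (hE : IsTOMOn S E) {x : V → Matrix (Fin d) (Fin d) ℂ}
    (hx : ∀ j ∈ S, x j = 0) : tomAct E x = 0 := by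
  funext i
  rw [tomAct_apply]
  refine Finset.sum_eq_zero fun j _ => ?_
  by_cases h : j ∈ S
  · simp [hx j h]
  · simp [hE.2.1 i j (Or.inr h)]

theorem IsTOMOn.tomAct_apply_eq_zero (hE : IsTOMOn S E) (x : V → Matrix (Fin d) (Fin d) ℂ)
    {i : V} (hi : i ∉ S) : tomAct E x i = 0 := by
  rw [tomAct_apply]
  exact Finset.sum_eq_zero fun j _ => by simp [hE.2.1 i j (Or.inl hi)]

theorem IsTOMOn.tomAct_posSemidef (hE : IsTOMOn S E) {x : V → Matrix (Fin d) (Fin d) ℂ}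
    (hx : ∀ j, (x j).PosSemidef) (i : V) : (tomAct E x i).PosSemidef := by
  rw [tomAct_apply]
  exact Matrix.posSemidef_sum _ fun j _ => (hE.1 i j).posSemidef (hx j)

theorem IsTOMOn.blockTrace_tomAct (hE : IsTOMOn S E) {x : V → Matrix (Fin d) (Fin d) ℂ}
    (hx : ∀ j ∉ S, x j = 0) : blockTrace (tomAct E x) = blockTrace x := by
  simp only [blockTrace, tomAct_apply, Matrix.trace_sum]
  rw [Finset.sum_comm]
  refine Finset.sum_congr rfl fun j _ => ?_
  rw [← Matrix.trace_sum]
  by_cases h : j ∈ S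
  · exact hE.2.2 j h (x j)
  · simp [hx j h]

theorem IsTOMOn.exitStep_pow_posSemidef (hE : IsTOMOn S E)
    {x : V → Matrix (Fin d) (Fin d) ℂ} (hx : ∀ j, (x j).PosSemidef) (n : ℕ) (j : V) :
    ((exitStep E T ^ n) x j).PosSemidef := by
  induction n generalizing j with
  | zero => simpa using hx j
  | succ n ih =>
    rw [pow_succ', Module.End.mul_apply, exitStep_apply]
    split_ifs
    exacts [Matrix.PosSemidef.zero, hE.tomAct_posSemidef ih j]

theorem exitStep_pow_succ_apply_eq_zero_of_mem (x : V → Matrix (Fin d) (Fin d) ℂ) (n : ℕ)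
    {j : V} (hj : j ∈ T) : (exitStep E T ^ (n + 1)) x j = 0 := by
  rw [pow_succ', Module.End.mul_apply, exitStep_apply, if_pos hj]

theorem IsTOMOn.exitStep_pow_apply_eq_zero (hE : IsTOMOn S E)
    {x : V → Matrix (Fin d) (Fin d) ℂ} (hx : ∀ j ∉ S, x j = 0) (n : ℕ) {j : V}
    (hj : j ∉ S) : (exitStep E T ^ n) x j = 0 := by
  cases n with
  | zero => simpa using hx j hj
  | succ n =>
    rw [pow_succ', Module.End.mul_apply, exitStep_apply, hE.tomAct_apply_eq_zero _ hj, ite_self]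

theorem IsTOMOn.blockTrace_retA (hE : IsTOMOn S E) (hTS : T ⊆ S)
    {x : V → Matrix (Fin d) (Fin d) ℂ} (hx : ∀ j ∉ T, x j = 0) (n : ℕ) :
    blockTrace (retA E T n x) =
      blockTrace ((exitStep E T ^ n) x) - blockTrace ((exitStep E T ^ (n + 1)) x) := by
  have hxS : ∀ j ∉ S, x j = 0 := fun j hj => hx j fun h => hj (hTS h)
  rw [retA_apply_of_support E hx, pow_succ', Module.End.mul_apply,
    ← hE.blockTrace_tomAct fun j hj => hE.exitStep_pow_apply_eq_zero hxS n hj,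
    ← blockTrace_sub]
  simp [exitStep]

/-- The return series from a density to its supporting sites converges, with sum at most `1`. -/
theorem IsTOMOn.summable_retA_and_returnProb_le_one (hE : IsTOMOn S E) (hTS : T ⊆ S)
    {ρ : V → Matrix (Fin d) (Fin d) ℂ} (hρ : DensityOn T ρ) :
    Summable (fun n => (blockTrace (retA E T n ρ)).re) ∧ returnProb E T ρ ≤ 1 := by
  have hnonneg : ∀ n, 0 ≤ (blockTrace (retA E T n ρ)).re := fun n => by
    rw [retA_apply_of_support E hρ.2.1]
    exact blockTrace_re_nonneg <| siteProj_posSemidef T <|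
      hE.tomAct_posSemidef <| hE.exitStep_pow_posSemidef hρ.1 n
  have hpartial : ∀ n, ∑ k ∈ Finset.range n, (blockTrace (retA E T k ρ)).re ≤ 1 := fun n => by
    simp only [hE.blockTrace_retA hTS hρ.2.1, Complex.sub_re]
    rw [Finset.sum_range_sub']
    have := blockTrace_re_nonneg (hE.exitStep_pow_posSemidef (T := T) hρ.1 n)
    simp only [pow_zero, Module.End.one_apply, hρ.2.2, Complex.one_re]
    linarith
  exact ⟨summable_of_sum_range_le hnonneg hpartial, Real.tsum_le_of_sum_range_le hnonneg hpartial⟩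

end TOM

section Decomposition

variable {Vm V0 Vp : Finset V}
  {E EL ER E0 : V → V → (Matrix (Fin d) (Fin d) ℂ →ₗ[ℂ] Matrix (Fin d) (Fin d) ℂ)}

theorem tomAct_decomposition (hdec : ∀ i j, E i j = EL i j + ER i j - E0 i j)
    (x : V → Matrix (Fin d) (Fin d) ℂ) :
    tomAct E x = tomAct EL x + tomAct ER x - tomAct E0 x := by
  funext i
  simp [tomAct_apply, hdec, Finset.sum_add_distrib, Finset.sum_sub_distrib]

/-- Once the walk has left the overlap, it evolves by `EL` or `ER` alone. -/
theorem tomAct_exitStep_add (hd1 : Disjoint Vm V0) (hd2 : Disjoint V0 Vp)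
    (hd3 : Disjoint Vm Vp)
    (hL : IsTOMOn (Vm ∪ V0) EL) (hR : IsTOMOn (V0 ∪ Vp) ER) (h0 : IsTOMOn V0 E0)
    (hdec : ∀ i j, E i j = EL i j + ER i j - E0 i j)
    {x : V → Matrix (Fin d) (Fin d) ℂ} (hx : ∀ j ∉ V0, x j = 0) (n : ℕ) :
    tomAct E ((exitStep EL V0 ^ (n + 1)) x + (exitStep ER V0 ^ (n + 1)) x) =
      tomAct EL ((exitStep EL V0 ^ (n + 1)) x) + tomAct ER ((exitStep ER V0 ^ (n + 1)) x) := by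
  have hLR : tomAct ER ((exitStep EL V0 ^ (n + 1)) x) = 0 := hR.tomAct_eq_zero fun j hj => by
    rcases Finset.mem_union.1 hj with h | h
    · exact exitStep_pow_succ_apply_eq_zero_of_mem x n h
    · refine hL.exitStep_pow_apply_eq_zero (fun i hi => hx i ?_) _ ?_
      · exact fun h' => hi (Finset.mem_union_right _ h')
      · rw [Finset.mem_union, not_or]
        exact ⟨Finset.disjoint_right.1 hd3 h, Finset.disjoint_right.1 hd2 h⟩
  have hRL : tomAct EL ((exitStep ER V0 ^ (n + 1)) x) = 0 := hL.tomAct_eq_zero fun j hj => by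
    rcases Finset.mem_union.1 hj with h | h
    · refine hR.exitStep_pow_apply_eq_zero (fun i hi => hx i ?_) _ ?_
      · exact fun h' => hi (Finset.mem_union_left _ h')
      · rw [Finset.mem_union, not_or]
        exact ⟨Finset.disjoint_left.1 hd1 h, Finset.disjoint_left.1 hd3 h⟩
    · exact exitStep_pow_succ_apply_eq_zero_of_mem x n h
  have h0' : tomAct E0 ((exitStep EL V0 ^ (n + 1)) x + (exitStep ER V0 ^ (n + 1)) x) = 0 :=
    h0.tomAct_eq_zero fun j hj => by
      simp only [Pi.add_apply, exitStep_pow_succ_apply_eq_zero_of_mem x n hj, add_zero]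
  rw [tomAct_decomposition hdec, h0', map_add, map_add, hLR, hRL]
  simp

theorem exitStep_pow_succ_decomposition (hd1 : Disjoint Vm V0) (hd2 : Disjoint V0 Vp)
    (hd3 : Disjoint Vm Vp)
    (hL : IsTOMOn (Vm ∪ V0) EL) (hR : IsTOMOn (V0 ∪ Vp) ER) (h0 : IsTOMOn V0 E0)
    (hdec : ∀ i j, E i j = EL i j + ER i j - E0 i j)
    {x : V → Matrix (Fin d) (Fin d) ℂ} (hx : ∀ j ∉ V0, x j = 0) (n : ℕ) :
    (exitStep E V0 ^ (n + 1)) x =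
      (exitStep EL V0 ^ (n + 1)) x + (exitStep ER V0 ^ (n + 1)) x := by
  induction n with
  | zero =>
    funext i
    by_cases hi : i ∈ V0
    · simp [exitStep_apply, hi]
    · simp [exitStep_apply, hi, tomAct_decomposition hdec, h0.tomAct_apply_eq_zero x hi]
  | succ n ih =>
    simp only [pow_succ' _ (n + 1), Module.End.mul_apply, ih]
    simp only [exitStep, LinearMap.comp_apply, ← map_add]
    exact congrArg _ (tomAct_exitStep_add hd1 hd2 hd3 hL hR h0 hdec hx n)

theorem blockTrace_retA_decomposition (hd1 : Disjoint Vm V0) (hd2 : Disjoint V0 Vp)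
    (hd3 : Disjoint Vm Vp)
    (hL : IsTOMOn (Vm ∪ V0) EL) (hR : IsTOMOn (V0 ∪ Vp) ER) (h0 : IsTOMOn V0 E0)
    (hdec : ∀ i j, E i j = EL i j + ER i j - E0 i j)
    {x : V → Matrix (Fin d) (Fin d) ℂ} (hx : ∀ j ∉ V0, x j = 0) (n : ℕ) :
    blockTrace (retA E V0 n x) =
      blockTrace (retA EL V0 n x) + blockTrace (retA ER V0 n x) -
        if n = 0 then blockTrace x else 0 := by
  simp only [retA_apply_of_support _ hx]
  cases n with
  | zero =>
    have hP : siteProj V0 (tomAct E0 x) = tomAct E0 x :=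
      siteProj_of_support fun i hi => h0.tomAct_apply_eq_zero x hi
    simp only [pow_zero, Module.End.one_apply, tomAct_decomposition hdec, map_sub, map_add,
      blockTrace_sub, blockTrace_add, hP, h0.blockTrace_tomAct hx, if_true]
  | succ n =>
    rw [exitStep_pow_succ_decomposition hd1 hd2 hd3 hL hR h0 hdec hx,
      tomAct_exitStep_add hd1 hd2 hd3 hL hR h0 hdec hx, map_add, blockTrace_add]
    simp

end Decomposition

/-- Decomposition rule for the return probability: if a TOM `E`
has an overlapping decomposition `E = (E_L ⊕ 0₊) + (0₋ ⊕ E_R) − (0₋ ⊕ E₀ ⊕ 0₊)`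
with overlap `V₀`, then `π(ρ→S₀) = π_L(ρ→S₀) + π_R(ρ→S₀) − 1` for every density
`ρ` supported on `S₀`; consequently `S₀` is recurrent for `E` iff it is recurrent
for both `E_L` and `E_R`. -/
theorem tom_decomposition_return_probability
    (Vm V0 Vp : Finset V)
    (hd1 : Disjoint Vm V0) (hd2 : Disjoint V0 Vp) (hd3 : Disjoint Vm Vp)
    (hcover : Vm ∪ V0 ∪ Vp = Finset.univ)
    (E EL ER E0 : V → V → (Matrix (Fin d) (Fin d) ℂ →ₗ[ℂ] Matrix (Fin d) (Fin d) ℂ))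
    (hE : IsTOMOn Finset.univ E)
    (hL : IsTOMOn (Vm ∪ V0) EL) (hR : IsTOMOn (V0 ∪ Vp) ER) (h0 : IsTOMOn V0 E0)
    (hdec : ∀ i j, E i j = EL i j + ER i j - E0 i j) :
    (∀ ρ, DensityOn V0 ρ →
      returnProb E V0 ρ = returnProb EL V0 ρ + returnProb ER V0 ρ - 1) ∧
    (RecurrentOn E V0 ↔ RecurrentOn EL V0 ∧ RecurrentOn ER V0) := by
  have hL0 : V0 ⊆ Vm ∪ V0 := Finset.subset_union_right
  have hR0 : V0 ⊆ V0 ∪ Vp := Finset.subset_union_left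
  have key : ∀ ρ, DensityOn V0 ρ →
      returnProb E V0 ρ = returnProb EL V0 ρ + returnProb ER V0 ρ - 1 := by
    intro ρ hρ
    have hsumL := (hL.summable_retA_and_returnProb_le_one hL0 hρ).1.hasSum
    have hsumR := (hR.summable_retA_and_returnProb_le_one hR0 hρ).1.hasSum
    refine HasSum.tsum_eq (((hsumL.add hsumR).sub (hasSum_ite_eq 0 (1 : ℝ))).congr_fun ?_)
    intro n
    rw [blockTrace_retA_decomposition hd1 hd2 hd3 hL hR h0 hdec hρ.2.1, hρ.2.2]
    split_ifs <;> simp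
  refine ⟨key, fun h => ⟨fun ρ hρ => ?_, fun ρ hρ => ?_⟩, fun h ρ hρ => ?_⟩
  · linarith [key ρ hρ, h ρ hρ, (hL.summable_retA_and_returnProb_le_one hL0 hρ).2,
      (hR.summable_retA_and_returnProb_le_one hR0 hρ).2]
  · linarith [key ρ hρ, h ρ hρ, (hL.summable_retA_and_returnProb_le_one hL0 hρ).2,
      (hR.summable_retA_and_returnProb_le_one hR0 hρ).2]
  · rw [key ρ hρ, h.1 ρ hρ, h.2 ρ hρ]
    norm_num

end QMCTOM
end

section
/- Let E = (E_i^j)_{i,j∈V} be a TOM on a finite vertex set V with internal space ℂ^d, and let V = V₋ ∪ V₀ ∪ V₊ be a partition. Then E admits an overlapping decomposition E = (E_L ⊕ 0₊) + (0₋ ⊕ E_R) − (0₋ ⊕ E₀ ⊕ 0₊) with overlap V₀ (for some TOMs E_L on V_L = V₋ ∪ V₀, E_R on V_R = V₀ ∪ V₊, and E₀ on V₀) if and only if E_i^j = 0 whenever (i ∈ V₋ and j ∈ V₊) or (i ∈ V₊ and j ∈ V₋). -/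
open Matrix Filter
open scoped ComplexOrder ENNReal

namespace QMCTOM

variable {d : ℕ} {V : Type} [Fintype V] [DecidableEq V]

theorem IsCPMap.zero :
    IsCPMap (0 : Matrix (Fin d) (Fin d) ℂ →ₗ[ℂ] Matrix (Fin d) (Fin d) ℂ) :=
  ⟨0, fun _ => 0, fun ρ => by simp⟩

theorem IsCPMap.add {Φ Ψ : Matrix (Fin d) (Fin d) ℂ →ₗ[ℂ] Matrix (Fin d) (Fin d) ℂ}
    (hΦ : IsCPMap Φ) (hΨ : IsCPMap Ψ) : IsCPMap (Φ + Ψ) := by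
  obtain ⟨m, B, hB⟩ := hΦ
  obtain ⟨n, C, hC⟩ := hΨ
  refine ⟨m + n, Fin.append B C, fun ρ => ?_⟩
  simp [Fin.sum_univ_add, hB, hC]

theorem IsCPMap.sum {ι : Type*} (s : Finset ι)
    {Φ : ι → Matrix (Fin d) (Fin d) ℂ →ₗ[ℂ] Matrix (Fin d) (Fin d) ℂ}
    (h : ∀ i ∈ s, IsCPMap (Φ i)) : IsCPMap (∑ i ∈ s, Φ i) :=
  Finset.sum_induction Φ IsCPMap (fun _ _ => IsCPMap.add) IsCPMap.zero h

/-- The restriction of `E` to `S` in which every transition leaving `S` from a site `j ∈ S`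
is redirected to `j`. -/
noncomputable def redirect (S : Finset V)
    (E : V → V → (Matrix (Fin d) (Fin d) ℂ →ₗ[ℂ] Matrix (Fin d) (Fin d) ℂ)) (i j : V) :
    Matrix (Fin d) (Fin d) ℂ →ₗ[ℂ] Matrix (Fin d) (Fin d) ℂ :=
  if i ∈ S ∧ j ∈ S then E i j + if i = j then ∑ k ∈ Sᶜ, E k j else 0 else 0

theorem sum_redirect (S : Finset V)
    (E : V → V → (Matrix (Fin d) (Fin d) ℂ →ₗ[ℂ] Matrix (Fin d) (Fin d) ℂ))
    {j : V} (hj : j ∈ S) : ∑ i, redirect S E i j = ∑ i, E i j := by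
  simp only [redirect, hj, and_true]
  rw [← Finset.sum_filter, Finset.sum_add_distrib, Finset.filter_univ_mem,
    Finset.sum_ite_eq', if_pos hj, Finset.sum_add_sum_compl]

theorem IsTOMOn.redirect {E : V → V → (Matrix (Fin d) (Fin d) ℂ →ₗ[ℂ] Matrix (Fin d) (Fin d) ℂ)}
    (hE : IsTOMOn Finset.univ E) (S : Finset V) : IsTOMOn S (redirect S E) := by
  obtain ⟨hcp, -, htr⟩ := hE
  refine ⟨fun i j => ?_, fun i j h => if_neg (by tauto), fun j hj ρ => ?_⟩
  · unfold QMCTOM.redirect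
    split_ifs
    · exact (hcp i j).add (IsCPMap.sum _ fun k _ => hcp k j)
    · exact (hcp i j).add IsCPMap.zero
    · exact IsCPMap.zero
  · rw [← LinearMap.sum_apply, sum_redirect S E hj, LinearMap.sum_apply]
    exact htr j (Finset.mem_univ j) ρ

/-- Characterization of overlapping decompositions: a TOM `E`
admits an overlapping decomposition with overlap `V₀` along the partition
`V = V₋ ∪ V₀ ∪ V₊` iff `E_i^j = 0` whenever `i ∈ V₋, j ∈ V₊` or
`i ∈ V₊, j ∈ V₋`. -/
theorem tom_overlapping_decomposition_iff
    (Vm V0 Vp : Finset V)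
    (hd1 : Disjoint Vm V0) (hd2 : Disjoint V0 Vp) (hd3 : Disjoint Vm Vp)
    (hcover : Vm ∪ V0 ∪ Vp = Finset.univ)
    (E : V → V → (Matrix (Fin d) (Fin d) ℂ →ₗ[ℂ] Matrix (Fin d) (Fin d) ℂ))
    (hE : IsTOMOn Finset.univ E) :
    (∃ EL ER E0 : V → V → (Matrix (Fin d) (Fin d) ℂ →ₗ[ℂ] Matrix (Fin d) (Fin d) ℂ),
      IsTOMOn (Vm ∪ V0) EL ∧ IsTOMOn (V0 ∪ Vp) ER ∧ IsTOMOn V0 E0 ∧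
      ∀ i j, E i j = EL i j + ER i j - E0 i j) ↔
    (∀ i j, ((i ∈ Vm ∧ j ∈ Vp) ∨ (i ∈ Vp ∧ j ∈ Vm)) → E i j = 0) := by
  have mem (i : V) : i ∈ Vm ∧ i ∉ V0 ∧ i ∉ Vp ∨ i ∉ Vm ∧ i ∈ V0 ∧ i ∉ Vp ∨
      i ∉ Vm ∧ i ∉ V0 ∧ i ∈ Vp := by
    have hi : i ∈ Vm ∪ V0 ∪ Vp := hcover ▸ Finset.mem_univ i
    have : i ∈ Vm → i ∉ V0 := fun h => Finset.disjoint_left.1 hd1 h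
    have : i ∈ V0 → i ∉ Vp := fun h => Finset.disjoint_left.1 hd2 h
    have : i ∈ Vm → i ∉ Vp := fun h => Finset.disjoint_left.1 hd3 h
    simp only [Finset.mem_union] at hi
    tauto
  constructor
  · rintro ⟨EL, ER, E0, hL, hR, h0, h⟩ i j hij
    rw [h i j, hL.2.1 i j (by grind), hR.2.1 i j (by grind), h0.2.1 i j (by grind)]
    simp
  · intro h
    refine ⟨_, _, _, hE.redirect (Vm ∪ V0), hE.redirect (V0 ∪ Vp), hE.redirect V0,
      fun i j => ?_⟩
    have hcL : (Vm ∪ V0)ᶜ = Vp := by ext k; have := mem k; grind [Finset.mem_compl]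
    have hcR : (V0 ∪ Vp)ᶜ = Vm := by ext k; have := mem k; grind [Finset.mem_compl]
    have hc0 : V0ᶜ = Vm ∪ Vp := by ext k; have := mem k; grind [Finset.mem_compl]
    have hp (hj : j ∈ Vm) : ∑ k ∈ Vp, E k j = 0 :=
      Finset.sum_eq_zero fun k hk => h k j (.inr ⟨hk, hj⟩)
    have hm (hj : j ∈ Vp) : ∑ k ∈ Vm, E k j = 0 :=
      Finset.sum_eq_zero fun k hk => h k j (.inl ⟨hk, hj⟩)
    simp only [redirect, hcL, hcR, hc0, Finset.sum_union hd3, Finset.mem_union]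
    rcases mem i with ⟨hi, hi', hi''⟩ | ⟨hi, hi', hi''⟩ | ⟨hi, hi', hi''⟩ <;>
      rcases mem j with ⟨hj, hj', hj''⟩ | ⟨hj, hj', hj''⟩ | ⟨hj, hj', hj''⟩ <;>
      by_cases hij : i = j <;> simp_all
    abel

end QMCTOM
end
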